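/- For any fixed integer n ≥ 2 and every real ε > 0, there exists a constant C > 0 such that for all real V ≥ 1, |N_n(V) − ϑ_n·V^n/n| ≤ C·V^{n−1+ε}. -/

import Mathlib

/-- `ϑ_n`: the product over all primes `p` of `1 + (p^(n-1) - 1)/(p^(n+1) - p^n)`. -/
noncomputable def thetaN (n : ℕ) : ℝ :=
  ∏' p : Nat.Primes, (1 + ((p : ℝ) ^ (n - 1) - 1) / ((p : ℝ) ^ (n + 1) - (p : ℝ) ^ n))

/-- `N_n(V)`: the number of finite-index subgroups `L ⊆ ℤ^n` with `[ℤ^n : L] ≤ V`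
such that `ℤ^n/L` is cyclic. -/
noncomputable def cocyclicCount (n : ℕ) (V : ℝ) : ℕ :=
  Set.ncard {L : AddSubgroup (Fin n → ℤ) |
    L.index ≠ 0 ∧ (L.index : ℝ) ≤ V ∧ IsAddCyclic ((Fin n → ℤ) ⧸ L)}

open Finset
noncomputable def gN (n p : ℕ) : ℝ := ((p : ℝ) ^ (n - 1) - 1) / ((p : ℝ) ^ n - (p : ℝ) ^ (n-1))

noncomputable abbrev Fv {n m : ℕ} (v : Fin n → ZMod m) : (Fin n → ℤ) →ₗ[ℤ] ZMod m :=
  Fintype.linearCombination ℤ v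

theorem Fv_single {n m : ℕ} (v : Fin n → ZMod m) (i : Fin n) : Fv v (Pi.single i 1) = v i := by
  simp [Fv]

open Classical in
theorem fiber_card {n m : ℕ} [NeZero m] (v0 : Fin n → ZMod m) (h0 : Function.Surjective (Fv v0)) :
    #{v ∈ (univ.filter fun v : Fin n → ZMod m => Function.Surjective (Fv v)) |
      (Fv v).toAddMonoidHom.ker = (Fv v0).toAddMonoidHom.ker} = m.totient := by
  rw [← ZMod.card_units_eq_totient, ← Finset.card_univ]
  symm
  have key : ∀ (u : (ZMod m)) y, Fv (fun i => u * v0 i) y = u * Fv v0 y := by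
    intro u y
    simp only [Fv, Fintype.linearCombination_apply, Finset.mul_sum]
    refine Finset.sum_congr rfl fun i _ => ?_
    rw [mul_smul_comm]
  refine Finset.card_bij (fun u _ => fun i => (u : ZMod m) * v0 i) ?_ ?_ ?_
  · intro u _
    simp only [mem_filter, mem_univ, true_and]
    constructor
    · intro z
      obtain ⟨y, hy⟩ := h0 (((u⁻¹ : (ZMod m)ˣ) : ZMod m) * z)
      refine ⟨y, ?_⟩
      rw [key, hy]; simp
    · ext y
      simp only [AddMonoidHom.mem_ker, LinearMap.toAddMonoidHom_coe]
      rw [key]; simp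
  · intro u _ w _ h
    obtain ⟨y, hy⟩ := h0 1
    have := key u y
    rw [h, key w y, hy] at this
    ext; simpa using this.symm
  · intro v hv
    simp only [mem_filter, mem_univ, true_and] at hv
    obtain ⟨hs, hk⟩ := hv
    obtain ⟨x, hx⟩ := h0 1
    have hker : ∀ y, Fv v0 y = 0 → Fv v y = 0 := by
      intro y hy
      have : y ∈ (Fv v0).toAddMonoidHom.ker := by simpa [AddMonoidHom.mem_ker] using hy
      rw [← hk] at this
      simpa [AddMonoidHom.mem_ker] using this
    have h1 : ∀ y, Fv v y = Fv v x * Fv v0 y := by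
      intro y
      have := hker (y - ((Fv v0 y).val : ℤ) • x) (by
        rw [map_sub, map_zsmul, hx]; simp)
      rw [map_sub, map_zsmul, sub_eq_zero] at this
      rw [this]; simp [mul_comm]
    obtain ⟨y, hy⟩ := hs 1
    have h2 : Fv v x * Fv v0 y = 1 := by rw [← h1, hy]
    refine ⟨Units.mkOfMulEqOne _ _ h2, mem_univ _, ?_⟩
    funext i
    have h3 := h1 (Pi.single i 1)
    rw [Fv_single, Fv_single] at h3
    rw [h3]; simp

def Lset (n m : ℕ) : Set (AddSubgroup (Fin n → ℤ)) :=
  {L | L.index = m ∧ IsAddCyclic ((Fin n → ℤ) ⧸ L)}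

open Classical in
theorem Lset_eq (n m : ℕ) [NeZero m] : Lset n m =
   ((univ.filter fun v : Fin n → ZMod m => Function.Surjective (Fv v)).image
    (fun v => (Fv v).toAddMonoidHom.ker) : Finset _) := by
  ext L
  simp only [Lset, Set.mem_ofPred_eq, coe_image, Set.mem_image, mem_coe, mem_filter, mem_univ, true_and]
  constructor
  · rintro ⟨hi, hc⟩
    have hcard : Nat.card ((Fin n → ℤ) ⧸ L) = m := by rw [← hi]; rfl
    let e : ((Fin n → ℤ) ⧸ L) ≃+ ZMod m := ((zmodAddCyclicAddEquiv hc).symm.trans (ZMod.ringEquivCongr hcard).toAddEquiv)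
    let f : (Fin n → ℤ) →+ ZMod m := e.toAddMonoidHom.comp (QuotientAddGroup.mk' L)
    have hf : (Fv (fun i => f (Pi.single i 1))).toAddMonoidHom = f := by
      ext i
      simp [Fv]
    refine ⟨fun i => f (Pi.single i 1), ?_, ?_⟩
    · have : Function.Surjective f := e.surjective.comp (QuotientAddGroup.mk'_surjective L)
      rw [← hf] at this
      exact this
    · rw [hf]
      ext y
      simp [f, AddMonoidHom.mem_ker]
  · rintro ⟨v, hv, rfl⟩
    let e := QuotientAddGroup.quotientKerEquivOfSurjective (Fv v).toAddMonoidHom hv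
    constructor
    · rw [AddSubgroup.index, Nat.card_congr e.toEquiv, Nat.card_zmod]
    · exact isAddCyclic_of_surjective e.symm e.symm.surjective

open Classical in
theorem Lset_card (n m : ℕ) [NeZero m] :
   #(univ.filter fun v : Fin n → ZMod m => Function.Surjective (Fv v)) = (Lset n m).ncard * m.totient := by
  rw [Lset_eq, Set.ncard_coe_finset]
  apply Finset.card_eq_sum_card_image (fun v => (Fv v).toAddMonoidHom.ker) _ |>.trans
  rw [Finset.sum_const_nat]
  intro L hL
  obtain ⟨v0, h0, rfl⟩ := Finset.mem_image.1 hL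
  exact fiber_card v0 (by simpa using h0)

theorem surj_iff {n m : ℕ} [NeZero m] (v : Fin n → ZMod m) :
   Function.Surjective (Fv v) ↔ ∀ p ∈ m.primeFactors, ¬ ∀ i, p ∣ (v i).val := by
  constructor
  · intro h p hp hd
    have hpp := Nat.prime_of_mem_primeFactors hp
    have hpm := Nat.dvd_of_mem_primeFactors hp
    have : Fact p.Prime := ⟨hpp⟩
    obtain ⟨y, hy⟩ := h 1
    have : ZMod.castHom hpm (ZMod p) (Fv v y) = 0 := by
      simp only [Fv, Fintype.linearCombination_apply, map_sum, map_zsmul]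
      refine Finset.sum_eq_zero fun i _ => ?_
      have : ZMod.castHom hpm (ZMod p) (v i) = 0 := by
        rw [← ZMod.natCast_zmod_val (v i), map_natCast, ZMod.natCast_eq_zero_iff]
        exact hd i
      rw [this]; simp
    rw [hy, map_one] at this
    exact one_ne_zero this
  · intro h
    by_contra hs
    set H := (Fv v).toAddMonoidHom.range with hH
    have hne : H ≠ ⊤ := fun h => hs (AddMonoidHom.range_eq_top.1 h)
    have hi : H.index ≠ 1 := fun h => hne (AddSubgroup.index_eq_one.1 h)
    obtain ⟨p, hp, hpd⟩ := Nat.exists_prime_and_dvd hi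
    have hm : H.index ∣ m := by
      have := AddSubgroup.index_dvd_card H
      rwa [Nat.card_zmod] at this
    refine h p (Nat.mem_primeFactors.2 ⟨hp, hpd.trans hm, NeZero.ne m⟩) fun i => hpd.trans ?_
    have hgen : ∀ z : ZMod m ⧸ H, z ∈ AddSubgroup.zmultiples (QuotientAddGroup.mk' H 1) := by
      intro z
      obtain ⟨w, rfl⟩ := QuotientAddGroup.mk'_surjective H z
      refine ⟨w.val, ?_⟩
      simp only
      rw [← map_zsmul]; simp
    have hord : addOrderOf (QuotientAddGroup.mk' H 1) = H.index := by
      exact addOrderOf_eq_card_of_forall_mem_zmultiples hgen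
    rw [← hord, addOrderOf_dvd_iff_nsmul_eq_zero, ← map_nsmul]
    simp only [nsmul_eq_mul, ZMod.natCast_val, ZMod.cast_id', id_eq, mul_one, QuotientAddGroup.mk'_apply]
    rw [QuotientAddGroup.eq_zero_iff]
    exact ⟨Pi.single i 1, Fv_single v i⟩

theorem card_dvd (m d : ℕ) [NeZero m] (hd : d ∣ m) : #{x : ZMod m | d ∣ x.val} = m / d := by
  have hm := Nat.pos_of_ne_zero (NeZero.ne m)
  have hd0 := Nat.pos_of_dvd_of_pos hd hm
  rw [← Finset.card_range (m/d)]
  symm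
  refine Finset.card_bij (fun k _ => ((d * k : ℕ) : ZMod m)) ?_ ?_ ?_
  · intro k hk
    have : d * k < m := by
      rw [mem_range, Nat.lt_div_iff_mul_lt' hd] at hk; exact hk
    simp [-Nat.cast_mul, ZMod.val_cast_of_lt this]
  · intro k hk l hl h
    have hk' : d * k < m := by
      rw [mem_range, Nat.lt_div_iff_mul_lt' hd] at hk; exact hk
    have hl' : d * l < m := by
      rw [mem_range, Nat.lt_div_iff_mul_lt' hd] at hl; exact hl
    have := congrArg ZMod.val h
    rw [ZMod.val_cast_of_lt hk', ZMod.val_cast_of_lt hl'] at this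
    exact Nat.eq_of_mul_eq_mul_left hd0 this
  · intro x hx
    simp only [mem_filter, mem_univ, true_and] at hx
    obtain ⟨k, hk⟩ := hx
    refine ⟨k, ?_, ?_⟩
    · rw [mem_range, Nat.lt_div_iff_mul_lt' hd, ← hk]; exact ZMod.val_lt x
    · rw [← hk]; simp

open Classical in
theorem surj_card (n m : ℕ) [NeZero m] :
   (#(univ.filter fun v : Fin n → ZMod m => Function.Surjective (Fv v)) : ℝ) =
    m ^ n * ∏ p ∈ m.primeFactors, (1 - 1 / (p:ℝ)^n) := by
  have h1 : (#(univ.filter fun v : Fin n → ZMod m => Function.Surjective (Fv v)) : ℝ) =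
    ∑ v : Fin n → ZMod m, ∏ p ∈ m.primeFactors, (1 + - (if ∀ i, p ∣ (v i).val then (1:ℝ) else 0)) := by
    rw [Finset.card_filter, Nat.cast_sum]
    refine Finset.sum_congr rfl fun v _ => ?_
    rw [surj_iff]
    split_ifs with h
    · rw [Finset.prod_eq_one]
      · simp
      · intro p hp; rw [if_neg (h p hp)]; simp
    · push Not at h
      obtain ⟨p, hp, h⟩ := h
      rw [Finset.prod_eq_zero hp]
      · simp
      · rw [if_pos h]; simp
  rw [h1]
  simp_rw [sub_eq_add_neg, Finset.prod_one_add]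
  rw [Finset.sum_comm, Finset.mul_sum]
  refine Finset.sum_congr rfl fun s hs => ?_
  rw [mem_powerset] at hs
  have hpr : ∀ p ∈ s, p.Prime := fun p hp => Nat.prime_of_mem_primeFactors (hs hp)
  have hdv : ∀ x, (∏ p ∈ s, p) ∣ x ↔ ∀ p ∈ s, p ∣ x := fun x =>
    ⟨fun h p hp => (Finset.dvd_prod_of_mem _ hp).trans h,
     fun h => Finset.prod_primes_dvd x (fun p hp => (hpr p hp).prime) h⟩
  have hdm : (∏ p ∈ s, p) ∣ m := (hdv m).2 fun p hp => Nat.dvd_of_mem_primeFactors (hs hp)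
  have h2 : ∀ v : Fin n → ZMod m, ∏ p ∈ s, (- (if ∀ i, p ∣ (v i).val then (1:ℝ) else 0))
     = (∏ p ∈ s, (-1)) * if v ∈ Fintype.piFinset (fun _ : Fin n => ({x : ZMod m | (∏ p ∈ s, p) ∣ x.val} : Finset (ZMod m))) then 1 else 0 := by
    intro v
    have : ∀ p, (- (if ∀ i, p ∣ (v i).val then (1:ℝ) else 0)) = (-1) * (if ∀ i, p ∣ (v i).val then (1:ℝ) else 0) := by
      intro p; ring
    simp_rw [this]
    rw [Finset.prod_mul_distrib]
    congr 1
    rw [Finset.prod_ite_zero]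
    simp only [Finset.prod_const_one, Fintype.mem_piFinset, mem_filter, mem_univ, true_and, hdv]
    congr 1
    rw [eq_iff_iff]
    exact ⟨fun h i p hp => h p hp i, fun h p hp i => h i p hp⟩
  simp_rw [h2]
  rw [← Finset.mul_sum, Finset.sum_boole, Finset.filter_mem_eq_inter, Finset.univ_inter,
    Fintype.card_piFinset]
  simp only [card_dvd m _ hdm, Finset.prod_const, card_univ, Fintype.card_fin]
  have h3 : ∀ p : ℕ, -(1 / (p:ℝ)^n) = (-1) * (1/(p:ℝ)^n) := by intro p; ring
  simp_rw [h3]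
  rw [Finset.prod_mul_distrib, Finset.prod_const]
  rw [Nat.cast_pow, Nat.cast_div hdm]
  · simp only [one_div, Finset.prod_inv_distrib, Finset.prod_pow]
    push_cast
    rw [div_pow]; ring
  · have : (∏ p ∈ s, p) ≠ 0 := Finset.prod_ne_zero_iff.2 fun p hp => (hpr p hp).ne_zero
    exact_mod_cast this

theorem Lset_ncard (n m : ℕ) (hn : 2 ≤ n) [NeZero m] :
   ((Lset n m).ncard : ℝ) = m ^ (n-1) * ∏ p ∈ m.primeFactors, (1 + gN n p) := by
  classical
  have h1 := Lset_card n m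
  have h2 := surj_card n m
  rw [h1] at h2
  have h3 : (m.totient : ℝ) = m * ∏ p ∈ m.primeFactors, (1 - 1 / (p:ℝ)) := by
    have := Nat.totient_eq_mul_prod_factors m
    have h := congrArg (fun q : ℚ => (q : ℝ)) this
    push_cast at h
    simpa using h
  have h4 : (m.totient : ℝ) ≠ 0 := by
    have := Nat.totient_pos.2 (Nat.pos_of_ne_zero (NeZero.ne m))
    positivity
  apply mul_right_cancel₀ h4
  push_cast at h2
  rw [h2, h3]
  have h5 : ∏ p ∈ m.primeFactors, (1 - 1 / (p:ℝ)^n) =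
    (∏ p ∈ m.primeFactors, (1 + gN n p)) * ∏ p ∈ m.primeFactors, (1 - 1 / (p:ℝ)) := by
    rw [← Finset.prod_mul_distrib]
    refine Finset.prod_congr rfl fun p hp => ?_
    have hp2 : (2:ℝ) ≤ p := by exact_mod_cast (Nat.prime_of_mem_primeFactors hp).two_le
    obtain ⟨k, rfl⟩ : ∃ k, n = k + 1 := ⟨n - 1, by omega⟩
    simp only [gN, Nat.add_sub_cancel]
    have : (p:ℝ)^(k+1) - p^k = p^k * (p - 1) := by ring
    rw [this]
    have : (p:ℝ) - 1 ≠ 0 := by linarith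
    have : (p:ℝ) ≠ 0 := by linarith
    field_simp
    ring
  rw [h5]
  have : (m:ℝ)^n = m^(n-1) * m := by rw [← pow_succ]; congr 1; omega
  rw [this]; ring

theorem gN_bounds (n p : ℕ) (hn : 2 ≤ n) (hp : 2 ≤ p) : 0 ≤ gN n p ∧ gN n p ≤ 2 / p := by
  have hp2 : (2:ℝ) ≤ p := by exact_mod_cast hp
  obtain ⟨k, rfl⟩ : ∃ k, n = k + 1 := ⟨n - 1, by omega⟩
  simp only [gN, Nat.add_sub_cancel]
  have h1 : (p:ℝ)^(k+1) - p^k = p^k * (p - 1) := by ring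
  rw [h1]
  have h2 : (1:ℝ) ≤ (p:ℝ)^k := one_le_pow₀ (by linarith)
  have h3 : (0:ℝ) < p - 1 := by linarith
  constructor
  · apply div_nonneg <;> nlinarith
  · rw [div_le_div_iff₀ (by positivity) (by linarith)]
    nlinarith [mul_nonneg (by linarith : (0:ℝ) ≤ (p:ℝ)^k) (by linarith : (0:ℝ) ≤ (p:ℝ) - 2)]

theorem g_summable (n : ℕ) (hn : 2 ≤ n) (δ : ℝ) (hδ : 0 < δ) :
    Summable fun p : Nat.Primes => gN n p * (p:ℝ) ^ (-δ) := by
  have h := (Nat.Primes.summable_rpow (r := -1 - δ)).2 (by linarith)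
  refine Summable.of_nonneg_of_le (fun p => ?_) (fun p => ?_) (h.mul_left 2)
  · exact mul_nonneg (gN_bounds n p hn p.2.two_le).1 (by positivity)
  · have hp : (0:ℝ) < p := by exact_mod_cast p.2.pos
    have := (gN_bounds n p hn p.2.two_le).2
    calc gN n p * (p:ℝ)^(-δ) ≤ 2 / p * (p:ℝ)^(-δ) := by gcongr
      _ = 2 * (p:ℝ)^(-1-δ) := by
        rw [sub_eq_add_neg, Real.rpow_add hp, Real.rpow_neg_one]; ring

noncomputable def gs (n : ℕ) (s : Finset Nat.Primes) : ℝ := ∏ p ∈ s, gN n p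
def Ds (s : Finset Nat.Primes) : ℕ := ∏ p ∈ s, (p : ℕ)

theorem Ds_pos (s : Finset Nat.Primes) : 0 < Ds s := Finset.prod_pos fun p _ => p.2.pos

theorem gs_nonneg (n : ℕ) (hn : 2 ≤ n) (s) : 0 ≤ gs n s :=
  Finset.prod_nonneg fun p _ => (gN_bounds n p hn p.2.two_le).1

theorem gs_summable (n : ℕ) (hn : 2 ≤ n) (δ : ℝ) (hδ : 0 < δ) :
    Summable fun s => gs n s * (Ds s : ℝ) ^ (-δ) := by
  have := summable_finsetProd_of_summable_nonneg
    (fun p : Nat.Primes => mul_nonneg (gN_bounds n p hn p.2.two_le).1 (by positivity)) (g_summable n hn δ hδ)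
  refine this.congr fun s => ?_
  rw [Finset.prod_mul_distrib, gs, Ds, Nat.cast_prod, Real.finsetProd_rpow]
  intro i _; positivity

theorem theta_hasSum (n : ℕ) (hn : 2 ≤ n) : HasSum (fun s => gs n s / Ds s) (thetaN n) := by
  have h1 : ∀ s, gs n s / Ds s = ∏ p ∈ s, (gN n (p : Nat.Primes) / (p:ℝ)) := by
    intro s
    rw [Finset.prod_div_distrib, gs, Ds, Nat.cast_prod]
  have h := gs_summable n hn 1 one_pos
  simp_rw [Real.rpow_neg_one, ← div_eq_mul_inv, h1] at h
  simp_rw [h1]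
  have h2 := tprod_one_add h
  have h3 : thetaN n = ∏' p : Nat.Primes, (1 + gN n p / (p:ℝ)) := by
    rw [thetaN]
    congr 1
    funext p
    rw [gN, div_div]
    congr 3
    obtain ⟨k, rfl⟩ : ∃ k, n = k + 1 := ⟨n - 1, by omega⟩
    simp only [Nat.add_sub_cancel]
    ring
  rw [h3, h2]
  exact h.hasSum

def PF (m : ℕ) : Finset Nat.Primes := m.primeFactors.subtype Nat.Prime

theorem mem_PF (m : ℕ) (p : Nat.Primes) : p ∈ PF m ↔ (p : ℕ) ∈ m.primeFactors :=
  Finset.mem_subtype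

theorem Ds_dvd_iff (s : Finset Nat.Primes) (m : ℕ) (hm : m ≠ 0) :
    Ds s ∣ m ↔ s ∈ (PF m).powerset := by
  rw [mem_powerset]
  constructor
  · intro h p hp
    rw [mem_PF]
    exact Nat.mem_primeFactors.2 ⟨p.2, (Finset.dvd_prod_of_mem (fun p : Nat.Primes => (p:ℕ)) hp).trans h, hm⟩
  · intro h
    rw [Ds, ← Finset.prod_image (s := s) (g := fun p : Nat.Primes => (p:ℕ)) (f := fun x => x) (by
      intro a _ b _ hab; exact Subtype.ext hab)]
    refine Finset.prod_primes_dvd m ?_ ?_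
    · intro p hp
      obtain ⟨q, _, rfl⟩ := Finset.mem_image.1 hp
      exact q.2.prime
    · intro p hp
      obtain ⟨q, hq, rfl⟩ := Finset.mem_image.1 hp
      exact Nat.dvd_of_mem_primeFactors ((mem_PF _ _).1 (h hq))

theorem Lset_hasSum (n m : ℕ) (hn : 2 ≤ n) (hm : m ≠ 0) :
    HasSum (fun s => gs n s * if Ds s ∣ m then (m:ℝ)^(n-1) else 0) ((Lset n m).ncard : ℝ) := by
  have : NeZero m := ⟨hm⟩
  have h1 : ((Lset n m).ncard : ℝ) = ∑ s ∈ (PF m).powerset,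
      gs n s * if Ds s ∣ m then (m:ℝ)^(n-1) else 0 := by
    rw [Lset_ncard n m hn]
    have : ∏ p ∈ m.primeFactors, (1 + gN n p) = ∏ p ∈ PF m, (1 + gN n p) := by
      exact (Finset.prod_subtype_of_mem (fun p => 1 + gN n p)
        (fun x hx => Nat.prime_of_mem_primeFactors hx)).symm
    rw [this, Finset.prod_one_add, Finset.mul_sum]
    refine Finset.sum_congr rfl fun s hs => ?_
    rw [if_pos ((Ds_dvd_iff s m hm).2 hs), mul_comm]; rfl
  rw [h1]
  apply hasSum_sum_of_ne_finset_zero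
  intro s hs
  rw [if_neg (fun h => hs ((Ds_dvd_iff s m hm).1 h)), mul_zero]

theorem count_eq (n : ℕ) (V : ℝ) (hV : 1 ≤ V) :
    cocyclicCount n V = ∑ m ∈ Icc 1 ⌊V⌋₊, (Lset n m).ncard := by
  classical
  have hfin : ∀ m ∈ Icc 1 ⌊V⌋₊, (Lset n m).Finite := by
    intro m hm
    have : NeZero m := ⟨by rw [mem_Icc] at hm; omega⟩
    rw [Lset_eq]; exact Finset.finite_toSet _
  have hset : {L : AddSubgroup (Fin n → ℤ) |
    L.index ≠ 0 ∧ (L.index : ℝ) ≤ V ∧ IsAddCyclic ((Fin n → ℤ) ⧸ L)} = ⋃ m ∈ (Icc 1 ⌊V⌋₊), Lset n m := by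
    ext L
    simp only [Lset, Set.mem_ofPred_eq, Set.mem_iUnion, mem_Icc, exists_prop]
    constructor
    · rintro ⟨h1, h2, h3⟩
      exact ⟨L.index, ⟨Nat.pos_of_ne_zero h1, Nat.le_floor h2⟩, rfl, h3⟩
    · rintro ⟨m, ⟨h1, h2⟩, rfl, h3⟩
      exact ⟨by omega, (Nat.le_floor_iff (by linarith)).1 h2, h3⟩
  rw [cocyclicCount, hset, ← Finset.set_biUnion_coe, (Finset.finite_toSet _).ncard_biUnion (fun i hi => hfin i (by simpa using hi)),
    finsum_mem_coe_finset]
  intro a _ b _ hab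
  refine Set.disjoint_left.2 fun L h1 h2 => hab ?_
  exact h1.1.symm.trans h2.1

theorem pow_diff (r k : ℕ) : ((r:ℝ)+1) * (k:ℝ)^r ≤ ((k:ℝ)+1)^(r+1) - (k:ℝ)^(r+1) ∧
    ((k:ℝ)+1)^(r+1) - (k:ℝ)^(r+1) ≤ ((r:ℝ)+1) * ((k:ℝ)+1)^r := by
  have h := geom_sum₂_mul ((k:ℝ)+1) k (r+1)
  rw [← h]
  simp only [add_sub_cancel_left, mul_one, Nat.add_sub_cancel]
  constructor
  · have : ((r:ℝ)+1) * (k:ℝ)^r = ∑ i ∈ range (r+1), (k:ℝ)^r := by simp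
    rw [this]
    refine Finset.sum_le_sum fun i hi => ?_
    have : r = i + (r - i) := by rw [mem_range] at hi; omega
    nth_rw 1 [this]
    rw [pow_add]
    gcongr
    linarith
  · have : ((r:ℝ)+1) * ((k:ℝ)+1)^r = ∑ i ∈ range (r+1), ((k:ℝ)+1)^r := by simp
    rw [this]
    refine Finset.sum_le_sum fun i hi => ?_
    have : r = i + (r - i) := by rw [mem_range] at hi; omega
    rw [show ((k:ℝ)+1)^r = ((k:ℝ)+1)^i * ((k:ℝ)+1)^(r-i) by rw [← pow_add, ← this]]
    gcongr
    linarith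

theorem sum_pow_lower (r K : ℕ) : (K:ℝ)^(r+1) / (r+1) ≤ ∑ k ∈ Icc 1 K, (k:ℝ)^r := by
  induction K with
  | zero => simp
  | succ K ih =>
    rw [Finset.sum_Icc_succ_top (by omega)]
    have := (pow_diff r K).2
    have h0 : (0:ℝ) < r + 1 := by positivity
    rw [div_le_iff₀ h0] at ih ⊢
    push_cast
    nlinarith

theorem sum_pow_upper (r K : ℕ) : ∑ k ∈ Icc 1 K, (k:ℝ)^r ≤ (K:ℝ)^(r+1) / (r+1) + K^r := by
  induction K with
  | zero => simp
  | succ K ih =>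
    rw [Finset.sum_Icc_succ_top (by omega)]
    have := (pow_diff r K).1
    have h0 : (0:ℝ) < r + 1 := by positivity
    have h1 : (K:ℝ)^(r+1) / (r+1) + K^r ≤ ((K + 1 : ℕ):ℝ)^(r+1) / (r+1) := by
      rw [le_div_iff₀ h0, add_mul, div_mul_cancel₀ _ h0.ne']
      push_cast
      nlinarith
    linarith

theorem sum_pow_err (r : ℕ) (δ : ℝ) (hδ : 0 < δ) (hδ1 : δ ≤ 1) (x : ℝ) (hx : 0 < x) :
    |∑ k ∈ Icc 1 ⌊x⌋₊, (k:ℝ)^r - x^(r+1)/(r+1)| ≤ 2^r * x^((r:ℝ)+δ) := by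
  rcases lt_or_ge x 1 with h | h
  · rw [Nat.floor_eq_zero.2 h]
    simp only [Icc_eq_empty_of_lt zero_lt_one, Finset.sum_empty, zero_sub, abs_neg]
    rw [abs_of_nonneg (by positivity)]
    calc x^(r+1)/(r+1) ≤ x^(r+1) := div_le_self (by positivity) (by linarith [(Nat.cast_nonneg r : (0:ℝ) ≤ r)])
      _ = x^((r:ℝ)+1) := by rw [← Real.rpow_natCast]; push_cast; rfl
      _ ≤ x^((r:ℝ)+δ) := Real.rpow_le_rpow_of_exponent_ge hx h.le (by linarith)
      _ ≤ 2^r * x^((r:ℝ)+δ) := le_mul_of_one_le_left (by positivity) (one_le_pow₀ (by norm_num))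
  · set K := ⌊x⌋₊
    have hK1 : (K:ℝ) ≤ x := Nat.floor_le hx.le
    have hK2 : x < K + 1 := Nat.lt_floor_add_one x
    have h0 : (0:ℝ) < r + 1 := by positivity
    have hl := sum_pow_lower r (K+1)
    have hu := sum_pow_upper r K
    rw [Finset.sum_Icc_succ_top (by omega)] at hl
    push_cast at hl
    have e1 : x^(r+1)/(r+1) ≤ ((K:ℝ)+1)^(r+1)/(r+1) := by gcongr
    have e2 : (K:ℝ)^(r+1)/(r+1) ≤ x^(r+1)/(r+1) := by gcongr
    have e3 : ((K:ℝ)+1)^r ≤ (2*x)^r := by gcongr; linarith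
    have e4 : (K:ℝ)^r ≤ (2*x)^r := by gcongr; linarith
    have e5 : (2*x)^r ≤ 2^r * x^((r:ℝ)+δ) := by
      rw [mul_pow]
      gcongr
      rw [← Real.rpow_natCast]
      exact Real.rpow_le_rpow_of_exponent_le h (by linarith)
    rw [abs_le]
    constructor <;> linarith

theorem T_eq (r d : ℕ) (hd : 0 < d) (V : ℝ) :
    ∑ m ∈ Icc 1 ⌊V⌋₊, (if d ∣ m then (m:ℝ)^r else 0) = (d:ℝ)^r * ∑ k ∈ Icc 1 ⌊V / d⌋₊, (k:ℝ)^r := by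
  rw [← Finset.sum_filter, Finset.mul_sum]
  symm
  rw [Nat.floor_div_natCast]
  refine Finset.sum_bij (fun k _ => d * k) ?_ ?_ ?_ ?_
  · intro k hk
    rw [mem_Icc] at hk
    rw [mem_filter, mem_Icc]
    refine ⟨⟨Nat.mul_pos hd hk.1, ?_⟩, Dvd.intro _ rfl⟩
    have := (Nat.le_div_iff_mul_le hd).1 hk.2
    rwa [mul_comm]
  · intro a _ b _ h
    exact Nat.eq_of_mul_eq_mul_left hd h
  · intro m hm
    rw [mem_filter, mem_Icc] at hm
    obtain ⟨⟨h1, h2⟩, k, rfl⟩ := hm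
    refine ⟨k, ?_, rfl⟩
    rw [mem_Icc]
    refine ⟨Nat.pos_of_mul_pos_left h1, (Nat.le_div_iff_mul_le hd).2 (by rwa [mul_comm])⟩
  · intro k _
    push_cast; rw [mul_pow]

theorem T_err (r d : ℕ) (hd : 0 < d) (δ : ℝ) (hδ : 0 < δ) (hδ1 : δ ≤ 1) (V : ℝ) (hV : 0 < V) :
    |∑ m ∈ Icc 1 ⌊V⌋₊, (if d ∣ m then (m:ℝ)^r else 0) - V^(r+1)/((r+1) * d)| ≤
      2^r * V^((r:ℝ)+δ) * (d:ℝ)^(-δ) := by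
  rw [T_eq r d hd]
  have hd' : (0:ℝ) < d := by exact_mod_cast hd
  have h := sum_pow_err r δ hδ hδ1 (V/d) (by positivity)
  have e : (d:ℝ)^r * ∑ k ∈ Icc 1 ⌊V / d⌋₊, (k:ℝ)^r - V^(r+1)/((r+1) * d)
     = (d:ℝ)^r * (∑ k ∈ Icc 1 ⌊V / d⌋₊, (k:ℝ)^r - (V/d)^(r+1)/(r+1)) := by
    rw [mul_sub]; congr 1
    rw [div_pow, pow_succ (d:ℝ)]; field_simp
  rw [e, abs_mul, abs_of_nonneg (by positivity)]
  calc _ ≤ (d:ℝ)^r * (2^r * (V/d)^((r:ℝ)+δ)) := by gcongr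
    _ = _ := by
      rw [Real.div_rpow hV.le hd'.le, Real.rpow_add hd', Real.rpow_neg hd'.le, Real.rpow_natCast]
      field_simp

theorem cocyclic_asymptotic_error (n : ℕ) (hn : 2 ≤ n) (ε : ℝ) (hε : 0 < ε) :
    ∃ C > 0, ∀ V : ℝ, 1 ≤ V →
      |(cocyclicCount n V : ℝ) - thetaN n * V ^ n / n| ≤ C * V ^ ((n : ℝ) - 1 + ε) := by
  set δ := min ε 1
  have hδ : 0 < δ := lt_min hε one_pos
  have hδ1 : δ ≤ 1 := min_le_right _ _
  have hS := gs_summable n hn δ hδ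
  set S := ∑' s, gs n s * (Ds s : ℝ) ^ (-δ)
  have hS0 : 0 ≤ S := tsum_nonneg fun s => mul_nonneg (gs_nonneg n hn s) (by positivity)
  refine ⟨2^(n-1) * S + 1, by positivity, fun V hV => ?_⟩
  have hV0 : 0 < V := by linarith
  have h1 : HasSum (fun s => ∑ m ∈ Icc 1 ⌊V⌋₊, gs n s * if Ds s ∣ m then (m:ℝ)^(n-1) else 0)
      (cocyclicCount n V : ℝ) := by
    rw [count_eq n V hV, Nat.cast_sum]
    exact hasSum_sum fun m hm => Lset_hasSum n m hn (by rw [mem_Icc] at hm; omega)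
  have h2 := (theta_hasSum n hn).mul_right (V^n/n)
  have h3 := h1.sub h2
  have h4 := hS.hasSum.mul_left (2^(n-1) * V^((n:ℝ)-1+δ))
  have hb := tsum_of_norm_bounded (f := fun s => (∑ m ∈ Icc 1 ⌊V⌋₊, gs n s * if Ds s ∣ m then (m:ℝ)^(n-1) else 0) -
    gs n s / Ds s * (V^n/n)) h4 (fun s => by
      obtain ⟨r, rfl⟩ : ∃ k, n = k + 1 := ⟨n - 1, by omega⟩
      have hT := T_err r (Ds s) (Ds_pos s) δ hδ hδ1 V hV0
      have hD : (0:ℝ) < Ds s := by exact_mod_cast Ds_pos s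
      simp only [Nat.add_sub_cancel]
      push_cast
      rw [add_sub_cancel_right, ← Finset.mul_sum]
      have e : gs (r+1) s / Ds s * (V^(r+1)/((r:ℝ)+1)) = gs (r+1) s * (V^(r+1)/(((r:ℝ)+1) * Ds s)) := by
        field_simp
      rw [e, ← mul_sub, Real.norm_eq_abs, abs_mul, abs_of_nonneg (gs_nonneg _ hn s)]
      have := mul_le_mul_of_nonneg_left hT (gs_nonneg (r+1) hn s)
      linarith)
  rw [h3.tsum_eq, Real.norm_eq_abs, ← mul_div_assoc] at hb
  have hVd : V^((n:ℝ)-1+δ) ≤ V^((n:ℝ)-1+ε) :=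
    Real.rpow_le_rpow_of_exponent_le hV (by linarith [min_le_left ε 1])
  calc _ ≤ _ := hb
    _ = (2^(n-1) * S) * V^((n:ℝ)-1+δ) := by ring
    _ ≤ (2^(n-1) * S) * V^((n:ℝ)-1+ε) := by gcongr
    _ ≤ _ := by
      have : 0 ≤ V^((n:ℝ)-1+ε) := by positivity
      linarith
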